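/- Strong-secrecy achievability for the wiretap channel: consider a discrete memoryless wiretap channel p(y, z | x) on finite alphabets with legitimate receiver Y and wiretapper Z. For any input pmf p(x), every rate R with 0 ≤ R < I(X;Y) − I(X;Z) is achievable with strong secrecy: there exists a sequence of codes consisting of a uniform message M ∈ [1:⌈2^{nR}⌉], a stochastic encoder p^{enc}(x^n | m), and a decoder m̂(y^n), such that Pr{M̂ ≠ M} → 0 and ‖p(m, z^n) − p^U(m) p(z^n)‖ → 0 as n → ∞, where p(m, z^n) is the induced joint pmf of the message and the wiretapper's output and p^U is the uniform pmf on the message set. -/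

import Mathlib

open scoped BigOperators Classical

noncomputable section

/-- `p` is a probability mass function on `α`: nonnegative and summing to one. -/
def IsPmf {α : Type*} (p : α → ℝ) : Prop := (∀ a, 0 ≤ p a) ∧ HasSum p 1

/-- Total variation distance between two pmfs on the same alphabet:
`‖p − q‖ = (1/2) Σ |p − q|`. -/
def TV {α : Type*} (p q : α → ℝ) : ℝ := (1 / 2) * ∑' a, |p a - q a|

/-- Shannon entropy (base 2) of a pmf. -/
def H2 {α : Type*} (p : α → ℝ) : ℝ := ∑' a, -(p a * Real.logb 2 (p a))

/-- Pushforward (marginalization) of a pmf along a map. -/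
def pmap {α β : Type*} (f : α → β) (p : α → ℝ) : β → ℝ :=
  fun b => ∑' a, if f a = b then p a else 0

/-- Mutual information `I(A;B)` (base 2) of a joint pmf on `α × β`. -/
def MI {α β : Type*} (p : α × β → ℝ) : ℝ :=
  H2 (pmap Prod.fst p) + H2 (pmap Prod.snd p) - H2 p

/-- The number of messages `⌈2^{nR}⌉` corresponding to rate `R` at blocklength `n`. -/
def nMsg (n : ℕ) (r : ℝ) : ℕ := ⌈(2 : ℝ) ^ ((n : ℝ) * r)⌉₊

/-- The uniform pmf on `{0, 1, …, M−1} ⊆ ℕ`. -/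
def unifPmf (M : ℕ) (b : ℕ) : ℝ := if b < M then (M : ℝ)⁻¹ else 0

/-- The joint pmf of `(M, X^n, Y^n, Z^n)` induced by a uniform message, a stochastic
encoder and `n` memoryless uses of the wiretap channel `W`. -/
def wtInduced {𝒳 𝒴 𝒵 : Type} (n M : ℕ) (W : 𝒳 → 𝒴 × 𝒵 → ℝ)
    (enc : ℕ → (Fin n → 𝒳) → ℝ) :
    ℕ × (Fin n → 𝒳) × (Fin n → 𝒴) × (Fin n → 𝒵) → ℝ :=
  fun a => unifPmf M a.1 * enc a.1 a.2.1 * ∏ i, W (a.2.1 i) (a.2.2.1 i, a.2.2.2 i)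



section OneShot

variable {K A B C : Type} [Fintype K] [DecidableEq K] [Fintype A] [Fintype B] [Fintype C]

/-- Expectation over an i.i.d. codebook. -/
def EE (P : A → ℝ) (F : (K → A) → ℝ) : ℝ := ∑ c : K → A, (∏ k, P (c k)) * F c

theorem EE_prod (P : A → ℝ) (g : K → A → ℝ) :
    EE P (fun c : K → A => ∏ k, g k (c k)) = ∏ k, ∑ a, P a * g k a := by
  unfold EE
  rw [Finset.prod_univ_sum]
  simp [Fintype.piFinset_univ, Finset.prod_mul_distrib]

theorem EE_add (P : A → ℝ) (F G : (K → A) → ℝ) :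
    EE P (fun c => F c + G c) = EE P F + EE P G := by
  simp [EE, mul_add, Finset.sum_add_distrib]

theorem EE_mul (P : A → ℝ) (t : ℝ) (F : (K → A) → ℝ) :
    EE P (fun c => t * F c) = t * EE P F := by
  simp only [EE, Finset.mul_sum]
  exact Finset.sum_congr rfl fun c _ => by ring

theorem EE_sum {ι : Type} (s : Finset ι) (P : A → ℝ) (F : ι → (K → A) → ℝ) :
    EE P (fun c => ∑ i ∈ s, F i c) = ∑ i ∈ s, EE P (F i) := by
  simp only [EE, Finset.mul_sum]
  exact Finset.sum_comm

theorem EE_mono (P : A → ℝ) (hP : ∀ a, 0 ≤ P a) (F G : (K → A) → ℝ) (h : ∀ c, F c ≤ G c) :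
    EE P F ≤ EE P G :=
  Finset.sum_le_sum fun c _ => mul_le_mul_of_nonneg_left (h c) (Finset.prod_nonneg fun _ _ => hP _)

theorem EE_one (P : A → ℝ) (hP1 : ∑ a, P a = 1) (k : K) (g : A → ℝ) :
    EE P (fun c : K → A => g (c k)) = ∑ a, P a * g a := by
  have h := EE_prod P (fun j : K => if j = k then g else fun _ => 1)
  have h1 : ∀ c : K → A, (∏ j, (if j = k then g else fun _ => 1) (c j)) = g (c k) := by
    intro c
    rw [Finset.prod_eq_single k] <;> simp +contextual
  have h2 : (∏ j : K, ∑ a, P a * (if j = k then g else fun _ => 1) a) = ∑ a, P a * g a := by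
    rw [Finset.prod_eq_single k] <;> simp +contextual [hP1]
  simp only [h1] at h
  rw [h, h2]

theorem EE_const (P : A → ℝ) (hP1 : ∑ a, P a = 1) (t : ℝ) :
    EE P (fun _ : K → A => t) = t := by
  have h := EE_prod P (fun (_ : K) (_ : A) => (1 : ℝ))
  have := EE_mul P t (fun _ : K → A => (1 : ℝ))
  simp_all

theorem EE_two (P : A → ℝ) (hP1 : ∑ a, P a = 1) (k k' : K) (hk : k ≠ k') (g h : A → ℝ) :
    EE P (fun c : K → A => g (c k) * h (c k')) = (∑ a, P a * g a) * (∑ a, P a * h a) := by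
  have e := EE_prod P (fun j : K => if j = k then g else if j = k' then h else fun _ => 1)
  have h1 : ∀ c : K → A, (∏ j, (if j = k then g else if j = k' then h else fun _ => 1) (c j))
      = g (c k) * h (c k') := by
    intro c
    rw [← Finset.prod_subset (Finset.subset_univ {k, k'})]
    · rw [Finset.prod_pair hk]; simp [hk.symm]
    · intro x _ hx; simp at hx; simp [hx]
  have h2 : (∏ j : K, ∑ a, P a * (if j = k then g else if j = k' then h else fun _ => 1) a)
      = (∑ a, P a * g a) * (∑ a, P a * h a) := by
    rw [← Finset.prod_subset (Finset.subset_univ {k, k'})]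
    · rw [Finset.prod_pair hk]; simp [hk.symm]
    · intro x _ hx; simp at hx; simp [hx, hP1]
  simp only [h1] at e
  rw [e, h2]

theorem EE_abs_le (P : A → ℝ) (hP : ∀ a, 0 ≤ P a) (hP1 : ∑ a, P a = 1) (F : (K → A) → ℝ) :
    EE P (fun c => |F c|) ≤ √(EE P (fun c => F c ^ 2)) := by
  apply Real.le_sqrt_of_sq_le
  set t := EE P (fun c => |F c|) with ht
  have h0 : EE P (fun _ : K → A => (0 : ℝ)) ≤ EE P (fun c => F c ^ 2 + ((-2 * t) * |F c| + t ^ 2)) := by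
    apply EE_mono P hP
    intro c
    nlinarith [sq_nonneg (|F c| - t), sq_abs (F c)]
  rw [EE_const P hP1, EE_add, EE_add, EE_mul, EE_const P hP1, ← ht] at h0
  nlinarith

/-- variance of an average of i.i.d. centered variables -/
theorem EE_var (P : A → ℝ) (hP1 : ∑ a, P a = 1) {N : ℕ} (k : Fin N → K)
    (hk : Function.Injective k) (g : A → ℝ) (hg : ∑ a, P a * g a = 0) :
    EE P (fun c : K → A => (∑ l, g (c (k l))) ^ 2) = N * ∑ a, P a * g a ^ 2 := by
  have : ∀ c : K → A, (∑ l, g (c (k l))) ^ 2 = ∑ l, ∑ l', g (c (k l)) * g (c (k l')) := by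
    intro c; rw [sq, Finset.sum_mul_sum]
  simp only [this, EE_sum]
  have h2 : ∀ l l' : Fin N, EE P (fun c : K → A => g (c (k l)) * g (c (k l')))
      = if l = l' then ∑ a, P a * g a ^ 2 else 0 := by
    intro l l'
    split_ifs with h
    · subst h
      rw [EE_one P hP1 (k l) (fun a => g a * g a)]
      simp [sq]
    · rw [EE_two P hP1 _ _ (fun e => h (hk e)), hg, zero_mul]
  simp [h2]

theorem soft_cover (P : A → ℝ) (hP : ∀ a, 0 ≤ P a) (hP1 : ∑ a, P a = 1)
    (V : A → C → ℝ) (hV : ∀ a z, 0 ≤ V a z) (hV1 : ∀ a, ∑ z, V a z = 1)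
    (r : C → ℝ) (hr : ∀ z, r z = ∑ a, P a * V a z) (γ : ℝ) (hγ : 0 ≤ γ)
    {L : ℕ} (hL : 0 < L) (k : Fin L → K) (hk : Function.Injective k) :
    EE P (fun c : K → A => ∑ z, |(L : ℝ)⁻¹ * ∑ l, V (c (k l)) z - r z|) ≤
      2 * (∑ a, ∑ z, P a * V a z * (if γ * r z < V a z then 1 else 0)) + √(γ / L) := by
  have hL' : (0 : ℝ) < L := by exact_mod_cast hL
  have hr0 : ∀ z, 0 ≤ r z := fun z => by
    rw [hr]; exact Finset.sum_nonneg fun a _ => mul_nonneg (hP a) (hV a z)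
  have hr1 : ∑ z, r z = 1 := by
    simp only [hr]; rw [Finset.sum_comm]; simp [← Finset.mul_sum, hV1, hP1]
  have key : ∀ z, EE P (fun c : K → A => |(L : ℝ)⁻¹ * ∑ l, V (c (k l)) z - r z|) ≤
      2 * (∑ a, P a * V a z * (if γ * r z < V a z then 1 else 0)) + r z * √(γ / L) := by
    intro z
    set V1 : A → ℝ := fun a => V a z * (if γ * r z < V a z then 0 else 1) with hV1d
    set V2 : A → ℝ := fun a => V a z * (if γ * r z < V a z then 1 else 0) with hV2d
    have hV12 : ∀ a, V a z = V1 a + V2 a := fun a => by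
      simp only [hV1d, hV2d]; split_ifs <;> simp
    have hV1n : ∀ a, 0 ≤ V1 a := fun a => by
      simp only [hV1d]; split_ifs <;> simp [hV]
    have hV2n : ∀ a, 0 ≤ V2 a := fun a => by
      simp only [hV2d]; split_ifs <;> simp [hV]
    have hV1b : ∀ a, V1 a ≤ γ * r z := fun a => by
      simp only [hV1d]; split_ifs with h
      · simp [mul_nonneg hγ (hr0 z)]
      · simpa using h
    set r1 := ∑ a, P a * V1 a with hr1d
    set r2 := ∑ a, P a * V2 a with hr2d
    have hrr : r z = r1 + r2 := by
      rw [hr, hr1d, hr2d, ← Finset.sum_add_distrib]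
      exact Finset.sum_congr rfl fun a _ => by rw [hV12, mul_add]
    have hr2n : 0 ≤ r2 := Finset.sum_nonneg fun a _ => mul_nonneg (hP a) (hV2n a)
    have hr1n : 0 ≤ r1 := Finset.sum_nonneg fun a _ => mul_nonneg (hP a) (hV1n a)
    have hg : ∑ a, P a * (V1 a - r1) = 0 := by
      simp only [mul_sub, Finset.sum_sub_distrib, ← Finset.sum_mul, hP1]
      simp [hr1d]
    have hpt : ∀ c : K → A, |(L : ℝ)⁻¹ * ∑ l, V (c (k l)) z - r z| ≤
        (L : ℝ)⁻¹ * |∑ l, (V1 (c (k l)) - r1)| + ((L : ℝ)⁻¹ * ∑ l, V2 (c (k l)) + r2) := by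
      intro c
      have e : (L : ℝ)⁻¹ * ∑ l, V (c (k l)) z - r z =
          (L : ℝ)⁻¹ * (∑ l, (V1 (c (k l)) - r1)) + ((L : ℝ)⁻¹ * ∑ l, V2 (c (k l)) - r2) := by
        rw [hrr]
        simp only [hV12, Finset.sum_add_distrib, Finset.sum_sub_distrib, Finset.sum_const,
          Finset.card_univ, Fintype.card_fin, nsmul_eq_mul]
        field_simp
        ring
      have n2 : 0 ≤ (L : ℝ)⁻¹ * ∑ l, V2 (c (k l)) :=
        mul_nonneg (by positivity) (Finset.sum_nonneg fun _ _ => hV2n _)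
      rw [e]
      refine (abs_add_le _ _).trans ?_
      rw [abs_mul, abs_of_nonneg (inv_nonneg.2 hL'.le)]
      gcongr
      rw [abs_le]; constructor <;> linarith
    refine (EE_mono P hP _ _ hpt).trans ?_
    rw [EE_add, EE_add, EE_mul, EE_mul, EE_const P hP1, EE_sum]
    simp only [EE_one P hP1 _ V2, ← hr2d]
    have hvar : ∑ a, P a * (V1 a - r1) ^ 2 ≤ γ * r z ^ 2 := by
      calc ∑ a, P a * (V1 a - r1) ^ 2
          = ∑ a, P a * V1 a ^ 2 - r1 ^ 2 := by
            have : ∀ a, P a * (V1 a - r1) ^ 2 = P a * V1 a ^ 2 - 2 * r1 * (P a * V1 a) + P a * r1 ^ 2 :=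
              fun a => by ring
            simp only [this, Finset.sum_add_distrib, Finset.sum_sub_distrib, ← Finset.mul_sum,
              ← Finset.sum_mul, hP1, ← hr1d]
            ring
        _ ≤ ∑ a, P a * V1 a ^ 2 := by nlinarith
        _ ≤ ∑ a, P a * V1 a * (γ * r z) := by
            refine Finset.sum_le_sum fun a _ => ?_
            rw [sq, ← mul_assoc]
            exact mul_le_mul_of_nonneg_left (hV1b a) (mul_nonneg (hP a) (hV1n a))
        _ = r1 * (γ * r z) := by rw [← Finset.sum_mul]
        _ ≤ γ * r z ^ 2 := by
            have : r1 ≤ r z := by linarith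
            have := mul_le_mul_of_nonneg_right this (mul_nonneg hγ (hr0 z))
            nlinarith
    have hE : EE P (fun c : K → A => |∑ l, (V1 (c (k l)) - r1)|) ≤ L * (r z * √(γ / L)) := by
      refine (EE_abs_le P hP hP1 _).trans ?_
      rw [EE_var P hP1 k hk (fun a => V1 a - r1) hg]
      apply Real.sqrt_le_iff.2
      refine ⟨by have := hr0 z; positivity, ?_⟩
      rw [mul_pow, mul_pow, Real.sq_sqrt (by positivity)]
      have : (L : ℝ) ^ 2 * (r z ^ 2 * (γ / L)) = L * (γ * r z ^ 2) := by field_simp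
      rw [this]
      gcongr
    have h3 : (L : ℝ)⁻¹ * EE P (fun c : K → A => |∑ l, (V1 (c (k l)) - r1)|) ≤ r z * √(γ / L) := by
      rw [inv_mul_le_iff₀ hL']; exact hE
    have h4 : ∑ a, P a * V a z * (if γ * r z < V a z then 1 else 0) = r2 := by
      rw [hr2d]; exact Finset.sum_congr rfl fun a _ => by rw [hV2d]; ring
    rw [h4]
    simp only [Finset.sum_const, Finset.card_univ, Fintype.card_fin, nsmul_eq_mul]
    rw [← mul_assoc, inv_mul_cancel₀ hL'.ne']
    linarith
  rw [EE_sum]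
  refine (Finset.sum_le_sum fun z _ => key z).trans ?_
  rw [Finset.sum_add_distrib, ← Finset.sum_mul, hr1, one_mul, ← Finset.mul_sum, Finset.sum_comm]

theorem oneshot (P : A → ℝ) (hP : ∀ a, 0 ≤ P a) (hP1 : ∑ a, P a = 1)
    (W : A → B → ℝ) (hW : ∀ a y, 0 ≤ W a y) (hW1 : ∀ a, ∑ y, W a y = 1)
    (q : B → ℝ) (hq : ∀ y, q y = ∑ a, P a * W a y) (γ : ℝ) (hγ : 0 < γ)
    (V : A → C → ℝ) (hV : ∀ a z, 0 ≤ V a z) (hV1 : ∀ a, ∑ z, V a z = 1)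
    (r : C → ℝ) (hr : ∀ z, r z = ∑ a, P a * V a z) (γ' : ℝ) (hγ' : 0 ≤ γ')
    (M L : ℕ) (hM : 0 < M) (hL : 0 < L) :
    ∃ (c : Fin M × Fin L → A) (dec : B → ℕ),
      (M : ℝ)⁻¹ * ∑ m : Fin M, (L : ℝ)⁻¹ * ∑ l, ∑ y, W (c (m, l)) y *
          (if dec y = m then 0 else 1) +
      (M : ℝ)⁻¹ * ∑ m : Fin M, ∑ z, |(L : ℝ)⁻¹ * ∑ l, V (c (m, l)) z - r z| ≤
      ((∑ a, ∑ y, P a * W a y * (if γ * q y < W a y then 0 else 1)) + M * L / γ) +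
      (2 * (∑ a, ∑ z, P a * V a z * (if γ' * r z < V a z then 1 else 0)) + √(γ' / L)) := by
  have hL' : (0 : ℝ) < L := by exact_mod_cast hL
  have hM' : (0 : ℝ) < M := by exact_mod_cast hM
  have hq0 : ∀ y, 0 ≤ q y := fun y => by
    rw [hq]; exact Finset.sum_nonneg fun a _ => mul_nonneg (hP a) (hW a y)
  set dec : (Fin M × Fin L → A) → B → ℕ := fun c y =>
    if h : ∃ k : Fin M × Fin L, γ * q y < W (c k) y then ((Classical.choose h).1 : ℕ) else 0
    with hdec
  by_contra hcon
  push Not at hcon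
  have hlt := fun c => hcon c (dec c)
  set T := ((∑ a, ∑ y, P a * W a y * (if γ * q y < W a y then 0 else 1)) + M * L / γ) +
      (2 * (∑ a, ∑ z, P a * V a z * (if γ' * r z < V a z then 1 else 0)) + √(γ' / L)) with hT
  set τ := ∑ a, ∑ y, P a * W a y * (if γ * q y < W a y then 0 else 1) with hτ
  -- pointwise bound on the decoding error
  have hpt : ∀ (c : Fin M × Fin L → A),
      (M : ℝ)⁻¹ * ∑ m : Fin M, (L : ℝ)⁻¹ * ∑ l, ∑ y, W (c (m, l)) y *
          (if dec c y = m then 0 else 1) ≤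
      (M : ℝ)⁻¹ * ∑ m : Fin M, (L : ℝ)⁻¹ * ∑ l, ∑ y, (W (c (m, l)) y *
          (if γ * q y < W (c (m, l)) y then 0 else 1) +
        ∑ k ∈ Finset.univ.erase (m, l), W (c (m, l)) y * (if γ * q y < W (c k) y then 1 else 0)) := by
    intro c
    gcongr with m _ l _ y _
    rw [← Finset.mul_sum, ← mul_add]
    refine mul_le_mul_of_nonneg_left ?_ (hW _ _)
    have hs : ∀ k, (0 : ℝ) ≤ (if γ * q y < W (c k) y then 1 else 0) := fun k => by
      split_ifs <;> simp
    by_cases h1 : γ * q y < W (c (m, l)) y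
    · have hex : ∃ k : Fin M × Fin L, γ * q y < W (c k) y := ⟨_, h1⟩
      have hd : dec c y = ((Classical.choose hex).1 : ℕ) := by simp only [hdec]; rw [dif_pos hex]
      have hc := Classical.choose_spec hex
      rw [hd]
      set k0 := Classical.choose hex
      by_cases h2 : k0 = (m, l)
      · rw [h2]
        simp only [if_true]
        exact add_nonneg (by split_ifs <;> simp) (Finset.sum_nonneg fun k _ => hs k)
      · have : (1 : ℝ) ≤ ∑ k ∈ Finset.univ.erase (m, l), (if γ * q y < W (c k) y then 1 else 0) := by
          refine le_trans ?_ (Finset.single_le_sum (fun k _ => hs k)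
            (Finset.mem_erase.2 ⟨h2, Finset.mem_univ k0⟩))
          rw [if_pos hc]
        rw [if_pos h1]
        split_ifs <;> linarith
    · rw [if_neg h1]
      have : (0:ℝ) ≤ ∑ k ∈ Finset.univ.erase (m, l), (if γ * q y < W (c k) y then 1 else 0) :=
        Finset.sum_nonneg fun k _ => hs k
      split_ifs <;> linarith
  have hq1 : ∑ y, ∑ a, P a * W a y = 1 := by
    rw [Finset.sum_comm]; simp [← Finset.mul_sum, hW1, hP1]
  have hcross : ∑ y, q y * ∑ a, P a * (if γ * q y < W a y then 1 else 0) ≤ 1 / γ := by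
    rw [le_div_iff₀ hγ, Finset.sum_mul]
    refine le_of_le_of_eq ?_ hq1
    refine Finset.sum_le_sum fun y _ => ?_
    rw [mul_comm, ← mul_assoc, Finset.mul_sum]
    refine Finset.sum_le_sum fun a _ => ?_
    split_ifs with h
    · nlinarith [hP a]
    · simpa using mul_nonneg (hP a) (hW a y)
  have hE1 : EE P (fun c : Fin M × Fin L → A => (M : ℝ)⁻¹ * ∑ m : Fin M, (L : ℝ)⁻¹ * ∑ l, ∑ y, W (c (m, l)) y *
          (if dec c y = m then 0 else 1)) ≤ τ + M * L / γ := by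
    refine (EE_mono P hP _ _ hpt).trans ?_
    simp only [EE_mul, EE_sum, EE_add]
    have hb : ∀ (m : Fin M) (l : Fin L), ∑ y, (EE P (fun c : Fin M × Fin L → A => W (c (m, l)) y *
          (if γ * q y < W (c (m, l)) y then 0 else 1)) +
        ∑ k ∈ Finset.univ.erase (m, l), EE P (fun c : Fin M × Fin L → A =>
          W (c (m, l)) y * (if γ * q y < W (c k) y then 1 else 0))) ≤ τ + M * L / γ := by
      intro m l
      rw [Finset.sum_add_distrib]
      apply add_le_add
      · apply le_of_eq
        rw [hτ, Finset.sum_comm]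
        refine Finset.sum_congr rfl fun y _ => ?_
        rw [EE_one P hP1 (m, l) (fun a => W a y * (if γ * q y < W a y then 0 else 1))]
        exact Finset.sum_congr rfl fun a _ => by ring
      · rw [Finset.sum_comm]
        have : ∀ k ∈ Finset.univ.erase (m, l), ∑ y, EE P (fun c : Fin M × Fin L → A =>
          W (c (m, l)) y * (if γ * q y < W (c k) y then 1 else 0)) ≤ 1 / γ := by
          intro k hk
          refine le_trans (le_of_eq ?_) hcross
          refine Finset.sum_congr rfl fun y _ => ?_
          rw [EE_two P hP1 (m, l) k (Finset.ne_of_mem_erase hk).symm (fun a => W a y)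
            (fun a => if γ * q y < W a y then 1 else 0), ← hq]
        refine (Finset.sum_le_card_nsmul _ _ _ this).trans ?_
        rw [nsmul_eq_mul, mul_one_div]
        gcongr
        have : (Finset.univ.erase (m, l)).card ≤ M * L := by
          refine (Finset.card_le_univ _).trans ?_
          simp
        exact_mod_cast this
    rw [inv_mul_le_iff₀ hM']
    refine (Finset.sum_le_card_nsmul _ _ (τ + M * L / γ) fun m _ => ?_).trans (by simp [mul_add])
    rw [inv_mul_le_iff₀ hL']
    exact (Finset.sum_le_card_nsmul _ _ (τ + M * L / γ) fun l _ => hb m l).trans (by simp [mul_add])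
  have hE2 : EE P (fun c : Fin M × Fin L → A =>
      (M : ℝ)⁻¹ * ∑ m : Fin M, ∑ z, |(L : ℝ)⁻¹ * ∑ l, V (c (m, l)) z - r z|) ≤
      2 * (∑ a, ∑ z, P a * V a z * (if γ' * r z < V a z then 1 else 0)) + √(γ' / L) := by
    rw [EE_mul, EE_sum, inv_mul_le_iff₀ hM']
    refine (Finset.sum_le_card_nsmul _ _ _ fun m _ =>
      soft_cover P hP hP1 V hV hV1 r hr γ' hγ' hL (fun l => (m, l)) ?_).trans (by simp [mul_add])
    intro a b h; simpa using h
  have hE := add_le_add hE1 hE2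
  rw [← EE_add, ← hT] at hE
  -- contradiction
  have hpos : ∃ c : Fin M × Fin L → A, 0 < ∏ k, P (c k) := by
    by_contra h
    push Not at h
    have h1 := EE_const (K := Fin M × Fin L) P hP1 1
    have : EE P (fun _ : Fin M × Fin L → A => (1 : ℝ)) ≤ 0 :=
      Finset.sum_nonpos fun c _ => by simpa using h c
    linarith
  obtain ⟨c0, hc0⟩ := hpos
  have hlt2 : EE P (fun _ : Fin M × Fin L → A => T) < EE P (fun c : Fin M × Fin L → A =>
      (M : ℝ)⁻¹ * ∑ m : Fin M, (L : ℝ)⁻¹ * ∑ l, ∑ y, W (c (m, l)) y *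
          (if dec c y = m then 0 else 1) +
      (M : ℝ)⁻¹ * ∑ m : Fin M, ∑ z, |(L : ℝ)⁻¹ * ∑ l, V (c (m, l)) z - r z|) := by
    refine Finset.sum_lt_sum (fun c _ => ?_) ⟨c0, Finset.mem_univ _, ?_⟩
    · exact mul_le_mul_of_nonneg_left (hlt c).le (Finset.prod_nonneg fun _ _ => hP _)
    · exact mul_lt_mul_of_pos_left (hlt c0) hc0
  rw [EE_const P hP1] at hlt2
  linarith

end OneShot

section Letter

variable {X Y : Type} [Fintype X] [Fintype Y]

theorem sum_prod_pair (n : ℕ) (g : X → Y → ℝ) :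
    ∑ x : Fin n → X, ∑ y : Fin n → Y, ∏ i, g (x i) (y i) = (∑ a, ∑ b, g a b) ^ n := by
  have h1 : ∀ x : Fin n → X, ∑ y : Fin n → Y, ∏ i, g (x i) (y i) = ∏ i, ∑ b, g (x i) b := by
    intro x
    rw [Finset.prod_univ_sum]; simp [Fintype.piFinset_univ]
  simp only [h1]
  have h2 := Finset.prod_univ_sum (fun _ : Fin n => (Finset.univ : Finset X))
    (fun _ a => ∑ b, g a b)
  simp only [Fintype.piFinset_univ, Finset.prod_const, Finset.card_univ, Fintype.card_fin] at h2
  exact h2.symm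

theorem sum_prod_one (n : ℕ) (g : Fin n → Y → ℝ) :
    ∑ y : Fin n → Y, ∏ i, g i (y i) = ∏ i, ∑ b, g i b := by
  rw [Finset.prod_univ_sum]; simp [Fintype.piFinset_univ]

/-- Chernoff bound. -/
theorem chernoff (p : X → Y → ℝ) (hp : ∀ a b, 0 ≤ p a b) (hp1 : ∑ a, ∑ b, p a b = 1)
    (f : X → Y → ℝ) (hf : ∑ a, ∑ b, p a b * f a b < 0) :
    ∃ ρ : ℝ, 0 ≤ ρ ∧ ρ < 1 ∧ ∀ n : ℕ, ∑ x : Fin n → X, ∑ y : Fin n → Y,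
      (∏ i, p (x i) (y i)) * (if 0 ≤ ∑ i, f (x i) (y i) then 1 else 0) ≤ ρ ^ n := by
  have hd : HasDerivAt (fun s : ℝ => ∑ a, ∑ b, p a b * Real.exp (s * f a b))
      (∑ a, ∑ b, p a b * f a b) 0 := by
    apply HasDerivAt.fun_sum
    intro a _
    apply HasDerivAt.fun_sum
    intro b _
    have h := (((hasDerivAt_id (0 : ℝ)).mul_const (f a b)).exp).const_mul (p a b)
    simpa using h
  have hs := hd.tendsto_slope
  have hsub : Set.Ioi (0 : ℝ) ⊆ {0}ᶜ := fun x (hx : 0 < x) => hx.ne'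
  have hev := (hs.eventually (gt_mem_nhds hf)).filter_mono (nhdsWithin_mono (0 : ℝ) hsub)
  obtain ⟨s, hs1, hs0⟩ := (hev.and self_mem_nhdsWithin).exists
  have hs0 : 0 < s := hs0
  refine ⟨∑ a, ∑ b, p a b * Real.exp (s * f a b), ?_, ?_, ?_⟩
  · exact Finset.sum_nonneg fun a _ => Finset.sum_nonneg fun b _ =>
      mul_nonneg (hp a b) (Real.exp_pos _).le
  · rw [slope_def_field] at hs1
    simp only [zero_mul, Real.exp_zero, mul_one, hp1, sub_zero] at hs1
    have := (div_neg_iff.1 hs1)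
    rcases this with h | h <;> linarith
  · intro n
    rw [← sum_prod_pair]
    refine Finset.sum_le_sum fun x _ => Finset.sum_le_sum fun y _ => ?_
    rw [Finset.prod_mul_distrib, ← Real.exp_sum, ← Finset.mul_sum]
    refine mul_le_mul_of_nonneg_left ?_ (Finset.prod_nonneg fun _ _ => hp _ _)
    split_ifs with h
    · exact Real.one_le_exp (mul_nonneg hs0.le h)
    · exact (Real.exp_pos _).le

theorem H2_fin (p : X → ℝ) : H2 p = ∑ a, -(p a * Real.logb 2 (p a)) := tsum_fintype _

theorem pmap_fin (f : X → Y) (p : X → ℝ) (b : Y) :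
    pmap f p b = ∑ a, if f a = b then p a else 0 := tsum_fintype _

/-- information density -/
def idens (pX : X → ℝ) (w : X → Y → ℝ) (a : X) (b : Y) : ℝ :=
  Real.logb 2 (w a b) - Real.logb 2 (∑ a', pX a' * w a' b)

theorem MI_eq (pX : X → ℝ) (w : X → Y → ℝ)
    (hw1 : ∀ a, ∑ b, w a b = 1) :
    MI (fun a : X × Y => pX a.1 * w a.1 a.2) = ∑ a, ∑ b, pX a * w a b * idens pX w a b := by
  have h1 : pmap Prod.fst (fun a : X × Y => pX a.1 * w a.1 a.2) = pX := by
    funext x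
    rw [pmap_fin, Fintype.sum_prod_type]
    rw [Finset.sum_eq_single x]
    · simp [← Finset.mul_sum, hw1]
    · intro b _ hb; simp [hb]
    · simp
  have h2 : pmap Prod.snd (fun a : X × Y => pX a.1 * w a.1 a.2) = fun b => ∑ a, pX a * w a b := by
    funext y
    rw [pmap_fin, Fintype.sum_prod_type]
    simp
  unfold MI
  rw [h1, h2, H2_fin, H2_fin, H2_fin, Fintype.sum_prod_type]
  have e1 : ∑ a, -(pX a * Real.logb 2 (pX a)) = ∑ a, ∑ b, -(pX a * w a b * Real.logb 2 (pX a)) := by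
    refine Finset.sum_congr rfl fun a _ => ?_
    rw [Finset.sum_neg_distrib, ← Finset.sum_mul, ← Finset.mul_sum, hw1, mul_one]
  have e2 : ∑ b, -((∑ a, pX a * w a b) * Real.logb 2 (∑ a, pX a * w a b)) =
      ∑ a, ∑ b, -(pX a * w a b * Real.logb 2 (∑ a', pX a' * w a' b)) := by
    rw [Finset.sum_comm]
    refine Finset.sum_congr rfl fun b _ => ?_
    rw [Finset.sum_neg_distrib, ← Finset.sum_mul]
  rw [e1, e2, ← Finset.sum_add_distrib, ← Finset.sum_sub_distrib]
  refine Finset.sum_congr rfl fun a _ => ?_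
  rw [← Finset.sum_add_distrib, ← Finset.sum_sub_distrib]
  refine Finset.sum_congr rfl fun b _ => ?_
  unfold idens
  by_cases ha : pX a = 0
  · simp [ha]
  by_cases hb : w a b = 0
  · simp [hb]
  rw [Real.logb_mul ha hb]
  ring

theorem MI_nonneg' (pX : X → ℝ) (hX : ∀ a, 0 ≤ pX a) (hX1 : ∑ a, pX a = 1)
    (w : X → Y → ℝ) (hw : ∀ a b, 0 ≤ w a b)
    (hw1 : ∀ a, ∑ b, w a b = 1) :
    0 ≤ ∑ a, ∑ b, pX a * w a b * idens pX w a b := by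
  set q : Y → ℝ := fun b => ∑ a', pX a' * w a' b with hq
  have hq0 : ∀ b, 0 ≤ q b := fun b => Finset.sum_nonneg fun a _ => mul_nonneg (hX a) (hw a b)
  have hl2 : 0 < Real.log 2 := Real.log_pos (by norm_num)
  have key : ∀ a b, (pX a * w a b - pX a * q b) / Real.log 2 ≤ pX a * w a b * idens pX w a b := by
    intro a b
    by_cases ha : pX a = 0
    · simp [ha]
    by_cases hb : w a b = 0
    · simp only [hb, mul_zero, zero_mul, zero_sub]
      have := mul_nonneg (hX a) (hq0 b)
      exact div_nonpos_of_nonpos_of_nonneg (by linarith) hl2.le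
    have ha' : 0 < pX a := lt_of_le_of_ne (hX a) (Ne.symm ha)
    have hb' : 0 < w a b := lt_of_le_of_ne (hw a b) (Ne.symm hb)
    have hqp : 0 < q b := lt_of_lt_of_le (mul_pos ha' hb')
      (Finset.single_le_sum (f := fun a' => pX a' * w a' b)
        (fun a' _ => mul_nonneg (hX a') (hw a' b)) (Finset.mem_univ a))
    have h := Real.log_le_sub_one_of_pos (div_pos hqp hb')
    rw [Real.log_div hqp.ne' hb'.ne'] at h
    have h2 : w a b - q b ≤ w a b * (Real.log (w a b) - Real.log (q b)) := by
      have := mul_le_mul_of_nonneg_left h hb'.le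
      have e : w a b * (q b / w a b - 1) = q b - w a b := by field_simp
      rw [e] at this
      linarith
    unfold idens
    rw [div_le_iff₀ hl2]
    have e : pX a * w a b * (Real.logb 2 (w a b) - Real.logb 2 (∑ a', pX a' * w a' b)) * Real.log 2
        = pX a * (w a b * (Real.log (w a b) - Real.log (q b))) := by
      simp only [Real.logb, hq]; field_simp
    rw [e, ← mul_sub]
    exact mul_le_mul_of_nonneg_left h2 ha'.le
  refine le_trans (le_of_eq ?_) (Finset.sum_le_sum fun a _ => Finset.sum_le_sum fun b _ => key a b)
  have hqs : ∑ b, q b = 1 := by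
    simp only [hq]; rw [Finset.sum_comm]; simp [← Finset.mul_sum, hw1, hX1]
  simp [← Finset.sum_div, Finset.sum_sub_distrib, ← Finset.mul_sum, hw1, hqs]

/-- relation between thresholds on products and sums of information densities -/
theorem idens_sum (pX : X → ℝ) (hX : ∀ a, 0 ≤ pX a) (w : X → Y → ℝ) (hw : ∀ a b, 0 ≤ w a b)
    (n : ℕ) (x : Fin n → X) (y : Fin n → Y) (h : ∏ i, (pX (x i) * w (x i) (y i)) ≠ 0) :
    0 < ∏ i, w (x i) (y i) ∧ 0 < ∏ i, ∑ a, pX a * w a (y i) ∧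
    ∑ i, idens pX w (x i) (y i) =
      Real.logb 2 (∏ i, w (x i) (y i)) - Real.logb 2 (∏ i, ∑ a, pX a * w a (y i)) := by
  have h' : ∀ i, pX (x i) * w (x i) (y i) ≠ 0 := fun i => (Finset.prod_ne_zero_iff.1 h) i (Finset.mem_univ i)
  have hwp : ∀ i, 0 < w (x i) (y i) := fun i =>
    lt_of_le_of_ne (hw _ _) (Ne.symm (right_ne_zero_of_mul (h' i)))
  have hqp : ∀ i, 0 < ∑ a, pX a * w a (y i) := fun i =>
    lt_of_lt_of_le (lt_of_le_of_ne (mul_nonneg (hX _) (hw _ _)) (Ne.symm (h' i)))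
      (Finset.single_le_sum (f := fun a' => pX a' * w a' (y i))
        (fun a' _ => mul_nonneg (hX a') (hw a' (y i))) (Finset.mem_univ (x i)))
  refine ⟨Finset.prod_pos fun i _ => hwp i, Finset.prod_pos fun i _ => hqp i, ?_⟩
  rw [Real.logb_prod _ _ (fun i _ => (hwp i).ne'), Real.logb_prod _ _ (fun i _ => (hqp i).ne'),
    ← Finset.sum_sub_distrib]
  rfl

theorem tail_low (pX : X → ℝ) (hX : ∀ a, 0 ≤ pX a) (hX1 : ∑ a, pX a = 1)
    (w : X → Y → ℝ) (hw : ∀ a b, 0 ≤ w a b) (hw1 : ∀ a, ∑ b, w a b = 1) (t : ℝ)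
    (ht : t < ∑ a, ∑ b, pX a * w a b * idens pX w a b) :
    ∃ ρ : ℝ, 0 ≤ ρ ∧ ρ < 1 ∧ ∀ n : ℕ, ∑ x : Fin n → X, ∑ y : Fin n → Y,
      (∏ i, pX (x i)) * (∏ i, w (x i) (y i)) *
        (if (2 : ℝ) ^ ((n : ℝ) * t) * (∏ i, ∑ a, pX a * w a (y i)) < ∏ i, w (x i) (y i)
          then 0 else 1) ≤ ρ ^ n := by
  have hp1 : ∑ a, ∑ b, pX a * w a b = 1 := by simp [← Finset.mul_sum, hw1, hX1]
  obtain ⟨ρ, h0, h1, h⟩ := chernoff (fun a b => pX a * w a b) (fun a b => mul_nonneg (hX a) (hw a b))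
    hp1 (fun a b => t - idens pX w a b) (by
      simp only [mul_sub, Finset.sum_sub_distrib, ← Finset.sum_mul, hp1]
      linarith)
  refine ⟨ρ, h0, h1, fun n => le_trans ?_ (h n)⟩
  refine Finset.sum_le_sum fun x _ => Finset.sum_le_sum fun y _ => ?_
  rw [← Finset.prod_mul_distrib]
  by_cases hz : ∏ i, (pX (x i) * w (x i) (y i)) = 0
  · simp [hz]
  refine mul_le_mul_of_nonneg_left ?_ (Finset.prod_nonneg fun i _ => mul_nonneg (hX _) (hw _ _))
  obtain ⟨hwp, hqp, hs⟩ := idens_sum pX hX w hw n x y hz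
  split_ifs with c1 c2 c2
  · simp
  · simp
  · simp
  · exfalso
    apply c2
    rw [Finset.sum_sub_distrib, hs]
    simp only [Finset.sum_const, Finset.card_univ, Fintype.card_fin, nsmul_eq_mul]
    have := Real.logb_le_logb_of_le (b := 2) (by norm_num) hwp (not_lt.1 c1)
    rw [Real.logb_mul (by positivity) hqp.ne', Real.logb_rpow (by norm_num) (by norm_num)] at this
    linarith

theorem tail_high (pX : X → ℝ) (hX : ∀ a, 0 ≤ pX a) (hX1 : ∑ a, pX a = 1)
    (w : X → Y → ℝ) (hw : ∀ a b, 0 ≤ w a b) (hw1 : ∀ a, ∑ b, w a b = 1) (t : ℝ)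
    (ht : ∑ a, ∑ b, pX a * w a b * idens pX w a b < t) :
    ∃ ρ : ℝ, 0 ≤ ρ ∧ ρ < 1 ∧ ∀ n : ℕ, ∑ x : Fin n → X, ∑ y : Fin n → Y,
      (∏ i, pX (x i)) * (∏ i, w (x i) (y i)) *
        (if (2 : ℝ) ^ ((n : ℝ) * t) * (∏ i, ∑ a, pX a * w a (y i)) < ∏ i, w (x i) (y i)
          then 1 else 0) ≤ ρ ^ n := by
  have hp1 : ∑ a, ∑ b, pX a * w a b = 1 := by simp [← Finset.mul_sum, hw1, hX1]
  obtain ⟨ρ, h0, h1, h⟩ := chernoff (fun a b => pX a * w a b) (fun a b => mul_nonneg (hX a) (hw a b))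
    hp1 (fun a b => idens pX w a b - t) (by
      simp only [mul_sub, Finset.sum_sub_distrib, ← Finset.sum_mul, hp1]
      linarith)
  refine ⟨ρ, h0, h1, fun n => le_trans ?_ (h n)⟩
  refine Finset.sum_le_sum fun x _ => Finset.sum_le_sum fun y _ => ?_
  rw [← Finset.prod_mul_distrib]
  by_cases hz : ∏ i, (pX (x i) * w (x i) (y i)) = 0
  · simp [hz]
  refine mul_le_mul_of_nonneg_left ?_ (Finset.prod_nonneg fun i _ => mul_nonneg (hX _) (hw _ _))
  obtain ⟨hwp, hqp, hs⟩ := idens_sum pX hX w hw n x y hz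
  split_ifs with c1 c2 c2
  · simp
  · exfalso
    apply c2
    rw [Finset.sum_sub_distrib, hs]
    simp only [Finset.sum_const, Finset.card_univ, Fintype.card_fin, nsmul_eq_mul]
    have := Real.logb_le_logb_of_le (b := 2) (by norm_num) (by positivity) c1.le
    rw [Real.logb_mul (by positivity) hqp.ne', Real.logb_rpow (by norm_num) (by norm_num)] at this
    linarith
  · simp
  · simp

end Letter

section Assemble

theorem tsum_msg {F : Type} [Fintype F] (M : ℕ) (f : ℕ × F → ℝ)
    (h : ∀ m b, M ≤ m → f (m, b) = 0) : ∑' a, f a = ∑ m : Fin M, ∑ b, f (m, b) := by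
  rw [tsum_eq_sum (s := Finset.range M ×ˢ Finset.univ), Finset.sum_product,
    Finset.sum_range (fun m => ∑ b, f (m, b))]
  rintro ⟨m, b⟩ hb
  exact h m b (by simpa using hb)

/-- The encoder of a codebook: choose `l` uniformly and send `c (m, l)`. -/
def cbEnc {A : Type} {M L : ℕ} (hM : 0 < M) (c : Fin M × Fin L → A) (m : ℕ) (a : A) : ℝ :=
  (L : ℝ)⁻¹ * ∑ l, if c (⟨m % M, Nat.mod_lt m hM⟩, l) = a then 1 else 0

theorem cbEnc_pmf {A : Type} [Fintype A] {M L : ℕ} (hM : 0 < M) (hL : 0 < L)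
    (c : Fin M × Fin L → A) (m : ℕ) : IsPmf (cbEnc hM c m) := by
  have hL' : (L : ℝ) ≠ 0 := by exact_mod_cast hL.ne'
  constructor
  · intro a
    exact mul_nonneg (by positivity) (Finset.sum_nonneg fun l _ => by split_ifs <;> simp)
  · have : ∑ a, cbEnc hM c m a = 1 := by
      simp only [cbEnc]
      rw [← Finset.mul_sum, Finset.sum_comm]
      simp [hL']
    rw [← this]
    exact hasSum_fintype _

theorem cbEnc_sum {A : Type} [Fintype A] {M L : ℕ} (hM : 0 < M)
    (c : Fin M × Fin L → A) (m : Fin M) (g : A → ℝ) :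
    ∑ a, cbEnc hM c m a * g a = (L : ℝ)⁻¹ * ∑ l, g (c (m, l)) := by
  have hm : (⟨(m : ℕ) % M, Nat.mod_lt _ hM⟩ : Fin M) = m := by
    ext; exact Nat.mod_eq_of_lt m.2
  simp only [cbEnc, hm, mul_assoc, ← Finset.mul_sum, Finset.sum_mul]
  rw [Finset.sum_comm]
  simp

variable {𝒳 𝒴 𝒵 : Type} [Fintype 𝒳] [Fintype 𝒴] [Fintype 𝒵]

theorem unif_zero {M m : ℕ} (h : M ≤ m) : unifPmf M m = 0 := by
  simp [unifPmf, not_lt.2 h]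

theorem unif_fin {M : ℕ} (m : Fin M) : unifPmf M m = (M : ℝ)⁻¹ := by
  simp [unifPmf]

theorem err_eq (W : 𝒳 → 𝒴 × 𝒵 → ℝ) (n : ℕ) {M L : ℕ} (hM : 0 < M)
    (c : Fin M × Fin L → (Fin n → 𝒳)) (dec : (Fin n → 𝒴) → ℕ) :
    (∑' a : ℕ × (Fin n → 𝒳) × (Fin n → 𝒴) × (Fin n → 𝒵),
          wtInduced n M W (cbEnc hM c) a * (if dec a.2.2.1 = a.1 then 0 else 1)) =
    (M : ℝ)⁻¹ * ∑ m : Fin M, (L : ℝ)⁻¹ * ∑ l, ∑ y : Fin n → 𝒴,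
      (∏ i, ∑ z, W (c (m, l) i) (y i, z)) * (if dec y = m then 0 else 1) := by
  rw [tsum_msg M]
  · rw [Finset.mul_sum]
    refine Finset.sum_congr rfl fun m _ => ?_
    rw [← cbEnc_sum hM c m (fun x => ∑ y : Fin n → 𝒴,
      (∏ i, ∑ z, W (x i) (y i, z)) * (if dec y = m then 0 else 1)), Fintype.sum_prod_type,
      Finset.mul_sum]
    refine Finset.sum_congr rfl fun x _ => ?_
    rw [Fintype.sum_prod_type, Finset.mul_sum, Finset.mul_sum]
    refine Finset.sum_congr rfl fun y _ => ?_
    simp only [wtInduced, unif_fin]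
    rw [← sum_prod_one n (fun i z => W (x i) (y i, z))]
    by_cases h : dec y = (m : ℕ)
    · simp [h]
    · simp only [h, if_false, mul_one]
      rw [← Finset.mul_sum]
      ring
  · rintro m ⟨x, y, z⟩ h
    simp [wtInduced, unif_zero h]

theorem sum_y_z (W : 𝒳 → 𝒴 × 𝒵 → ℝ) (n : ℕ) (x : Fin n → 𝒳) (z : Fin n → 𝒵) :
    ∑ y : Fin n → 𝒴, ∏ i, W (x i) (y i, z i) = ∏ i, ∑ y, W (x i) (y, z i) :=
  sum_prod_one n (fun i y => W (x i) (y, z i))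

theorem pmz_eq (W : 𝒳 → 𝒴 × 𝒵 → ℝ) (n : ℕ) {M L : ℕ} (hM : 0 < M)
    (c : Fin M × Fin L → (Fin n → 𝒳)) (m : Fin M) (z : Fin n → 𝒵) :
    pmap (fun a : ℕ × (Fin n → 𝒳) × (Fin n → 𝒴) × (Fin n → 𝒵) => (a.1, a.2.2.2))
            (wtInduced n M W (cbEnc hM c)) ((m : ℕ), z) =
    (M : ℝ)⁻¹ * ((L : ℝ)⁻¹ * ∑ l, ∏ i, ∑ y, W (c (m, l) i) (y, z i)) := by
  unfold pmap
  rw [tsum_msg M]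
  · rw [Finset.sum_eq_single m]
    · rw [← cbEnc_sum hM c m (fun x => ∏ i, ∑ y, W (x i) (y, z i)), Fintype.sum_prod_type,
        Finset.mul_sum]
      refine Finset.sum_congr rfl fun x _ => ?_
      rw [Fintype.sum_prod_type]
      simp only [wtInduced, unif_fin, Prod.mk.injEq, true_and, Finset.sum_ite_eq', Finset.mem_univ,
        if_true]
      rw [← Finset.mul_sum, sum_y_z]
      ring
    · intro b _ hb
      have : (b : ℕ) ≠ m := fun h => hb (Fin.ext h)
      simp [this]
    · simp
  · rintro m ⟨x, y, z⟩ h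
    simp [wtInduced, unif_zero h]

theorem pz_eq (W : 𝒳 → 𝒴 × 𝒵 → ℝ) (n : ℕ) {M L : ℕ} (hM : 0 < M)
    (c : Fin M × Fin L → (Fin n → 𝒳)) (z : Fin n → 𝒵) :
    pmap (fun a : ℕ × (Fin n → 𝒳) × (Fin n → 𝒴) × (Fin n → 𝒵) => a.2.2.2)
            (wtInduced n M W (cbEnc hM c)) z =
    (M : ℝ)⁻¹ * ∑ m : Fin M, ((L : ℝ)⁻¹ * ∑ l, ∏ i, ∑ y, W (c (m, l) i) (y, z i)) := by
  unfold pmap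
  rw [tsum_msg M]
  · rw [Finset.mul_sum]
    refine Finset.sum_congr rfl fun m _ => ?_
    rw [← cbEnc_sum hM c m (fun x => ∏ i, ∑ y, W (x i) (y, z i)), Fintype.sum_prod_type,
        Finset.mul_sum]
    refine Finset.sum_congr rfl fun x _ => ?_
    rw [Fintype.sum_prod_type]
    simp only [wtInduced, unif_fin]
    rw [← sum_y_z, Finset.mul_sum, Finset.mul_sum]
    refine Finset.sum_congr rfl fun y _ => ?_
    rw [Finset.sum_eq_single z]
    · rw [if_pos rfl]; ring
    · intro b _ hb; rw [if_neg hb]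
    · simp
  · rintro m ⟨x, y, z⟩ h
    simp [wtInduced, unif_zero h]

theorem avg_bound {C : Type} [Fintype C] (M : ℕ) (hM : 0 < M) (p : Fin M → C → ℝ) (r : C → ℝ) :
    (1 / 2) * ∑ m : Fin M, ∑ z, |(M : ℝ)⁻¹ * p m z - (M : ℝ)⁻¹ * ((M : ℝ)⁻¹ * ∑ m', p m' z)| ≤
      (M : ℝ)⁻¹ * ∑ m : Fin M, ∑ z, |p m z - r z| := by
  have hM' : (0 : ℝ) < M := by exact_mod_cast hM
  have h1 : ∀ z, |(M : ℝ)⁻¹ * ∑ m', p m' z - r z| ≤ (M : ℝ)⁻¹ * ∑ m, |p m z - r z| := by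
    intro z
    have : (M : ℝ)⁻¹ * ∑ m', p m' z - r z = (M : ℝ)⁻¹ * ∑ m', (p m' z - r z) := by
      simp only [Finset.sum_sub_distrib, Finset.sum_const, Finset.card_univ, Fintype.card_fin,
        nsmul_eq_mul]
      field_simp
    rw [this, abs_mul, abs_of_pos (inv_pos.2 hM')]
    gcongr
    exact Finset.abs_sum_le_sum_abs _ _
  set S := ∑ m : Fin M, ∑ z, |p m z - r z| with hS
  have h2 : ∑ m : Fin M, ∑ z, |(M : ℝ)⁻¹ * p m z - (M : ℝ)⁻¹ * ((M : ℝ)⁻¹ * ∑ m', p m' z)| ≤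
      ∑ m : Fin M, ∑ z, ((M : ℝ)⁻¹ * |p m z - r z| + (M : ℝ)⁻¹ * ((M : ℝ)⁻¹ * ∑ m, |p m z - r z|)) := by
    refine Finset.sum_le_sum fun m _ => Finset.sum_le_sum fun z _ => ?_
    rw [← mul_sub, abs_mul, abs_of_pos (inv_pos.2 hM'), ← mul_add]
    refine mul_le_mul_of_nonneg_left ?_ (inv_pos.2 hM').le
    have := abs_sub_le (p m z) (r z) ((M : ℝ)⁻¹ * ∑ m', p m' z)
    rw [abs_sub_comm (r z)] at this
    linarith [h1 z]
  have h3 : ∑ m : Fin M, ∑ z, ((M : ℝ)⁻¹ * |p m z - r z| +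
      (M : ℝ)⁻¹ * ((M : ℝ)⁻¹ * ∑ m, |p m z - r z|)) = 2 * ((M : ℝ)⁻¹ * S) := by
    simp only [Finset.sum_add_distrib, ← Finset.mul_sum, Finset.sum_const, Finset.card_univ,
      Fintype.card_fin, nsmul_eq_mul]
    rw [Finset.sum_comm (s := (Finset.univ : Finset C)), ← hS]
    field_simp
    ring
  linarith

theorem tv_le (W : 𝒳 → 𝒴 × 𝒵 → ℝ) (n : ℕ) {M L : ℕ} (hM : 0 < M)
    (c : Fin M × Fin L → (Fin n → 𝒳)) (r : (Fin n → 𝒵) → ℝ) :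
    TV (pmap (fun a : ℕ × (Fin n → 𝒳) × (Fin n → 𝒴) × (Fin n → 𝒵) => (a.1, a.2.2.2))
            (wtInduced n M W (cbEnc hM c)))
          (fun mz : ℕ × (Fin n → 𝒵) => unifPmf M mz.1 *
            pmap (fun a : ℕ × (Fin n → 𝒳) × (Fin n → 𝒴) × (Fin n → 𝒵) => a.2.2.2)
              (wtInduced n M W (cbEnc hM c)) mz.2) ≤
    (M : ℝ)⁻¹ * ∑ m : Fin M, ∑ z, |(L : ℝ)⁻¹ * ∑ l, (∏ i, ∑ y, W (c (m, l) i) (y, z i)) - r z| := by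
  unfold TV
  rw [tsum_msg M]
  · simp only [pmz_eq, pz_eq, unif_fin]
    have h := avg_bound M hM (fun m z => (L : ℝ)⁻¹ * ∑ l, (∏ i, ∑ y, W (c (m, l) i) (y, z i))) r
    exact h
  · intro m z h
    have : pmap (fun a : ℕ × (Fin n → 𝒳) × (Fin n → 𝒴) × (Fin n → 𝒵) => (a.1, a.2.2.2))
            (wtInduced n M W (cbEnc hM c)) (m, z) = 0 := by
      unfold pmap
      refine (tsum_congr (g := fun _ => (0 : ℝ)) fun a => ?_).trans tsum_zero
      split_ifs with h'
      · have e : a.1 = m := congrArg Prod.fst h'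
        simp [wtInduced, e, unif_zero h]
      · rfl
    simp [this, unif_zero h]

theorem ceil_le_two (n : ℕ) (t : ℝ) (ht : 0 ≤ t) :
    (nMsg n t : ℝ) ≤ 2 * (2 : ℝ) ^ ((n : ℝ) * t) := by
  unfold nMsg
  have h1 : (1 : ℝ) ≤ (2 : ℝ) ^ ((n : ℝ) * t) := Real.one_le_rpow (by norm_num) (by positivity)
  have := (Nat.ceil_lt_add_one (zero_le_one.trans h1)).le
  linarith

theorem nMsg_pos (n : ℕ) (t : ℝ) : 0 < nMsg n t := Nat.ceil_pos.2 (by positivity)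

theorem rate_pow (n : ℕ) (t : ℝ) : (2 : ℝ) ^ ((n : ℝ) * t) = ((2 : ℝ) ^ t) ^ n := by
  rw [mul_comm, Real.rpow_mul (by norm_num), Real.rpow_natCast]

end Assemble

/-- Strong-secrecy achievability for the wiretap channel.  For any input pmf
`p_X`, every rate `R` with `0 ≤ R < I(X;Y) − I(X;Z)` is achievable with strong secrecy: for
every `ε > 0` there are `n`, a uniform message set `[0:⌈2^{nR}⌉)`, a stochastic encoder and
a decoder with error probability at most `ε` and
`‖p(m, z^n) − p^U(m) p(z^n)‖ ≤ ε`. -/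
theorem wiretap_channel_strong_secrecy
    {𝒳 𝒴 𝒵 : Type} [Fintype 𝒳] [Fintype 𝒴] [Fintype 𝒵]
    [Nonempty 𝒳] [Nonempty 𝒴] [Nonempty 𝒵]
    (W : 𝒳 → 𝒴 × 𝒵 → ℝ) (hW : ∀ x, IsPmf (W x))
    (pX : 𝒳 → ℝ) (hpX : IsPmf pX)
    (R : ℝ) (hR0 : 0 ≤ R)
    (hR : R < MI (pmap (fun a : 𝒳 × 𝒴 × 𝒵 => (a.1, a.2.1))
            (fun a : 𝒳 × 𝒴 × 𝒵 => pX a.1 * W a.1 a.2)) -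
          MI (pmap (fun a : 𝒳 × 𝒴 × 𝒵 => (a.1, a.2.2))
            (fun a : 𝒳 × 𝒴 × 𝒵 => pX a.1 * W a.1 a.2))) :
    ∀ ε > (0 : ℝ), ∃ (n : ℕ) (enc : ℕ → (Fin n → 𝒳) → ℝ) (dec : (Fin n → 𝒴) → ℕ),
      0 < n ∧
      (∀ m, IsPmf (enc m)) ∧
      (∑' a : ℕ × (Fin n → 𝒳) × (Fin n → 𝒴) × (Fin n → 𝒵),
          wtInduced n (nMsg n R) W enc a * (if dec a.2.2.1 = a.1 then 0 else 1)) ≤ ε ∧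
      TV (pmap (fun a : ℕ × (Fin n → 𝒳) × (Fin n → 𝒴) × (Fin n → 𝒵) => (a.1, a.2.2.2))
            (wtInduced n (nMsg n R) W enc))
          (fun mz : ℕ × (Fin n → 𝒵) => unifPmf (nMsg n R) mz.1 *
            pmap (fun a : ℕ × (Fin n → 𝒳) × (Fin n → 𝒴) × (Fin n → 𝒵) => a.2.2.2)
              (wtInduced n (nMsg n R) W enc) mz.2) ≤ ε := by
  intro ε hε
  have hX := hpX.1
  have hX1 : ∑ a, pX a = 1 := (hasSum_fintype pX).unique hpX.2
  have hW0 : ∀ x b, 0 ≤ W x b := fun x => (hW x).1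
  have hWs : ∀ x, ∑ y, ∑ z, W x (y, z) = 1 := fun x => by
    rw [← Fintype.sum_prod_type]
    exact (hasSum_fintype (W x)).unique (hW x).2
  have hWs' : ∀ x, ∑ z, ∑ y, W x (y, z) = 1 := fun x => by
    rw [Finset.sum_comm]; exact hWs x
  set w : 𝒳 → 𝒴 → ℝ := fun x y => ∑ z, W x (y, z) with hw
  set v : 𝒳 → 𝒵 → ℝ := fun x z => ∑ y, W x (y, z) with hv
  have hw0 : ∀ x y, 0 ≤ w x y := fun x y => Finset.sum_nonneg fun z _ => hW0 _ _
  have hv0 : ∀ x z, 0 ≤ v x z := fun x z => Finset.sum_nonneg fun y _ => hW0 _ _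
  have eY : pmap (fun a : 𝒳 × 𝒴 × 𝒵 => (a.1, a.2.1)) (fun a : 𝒳 × 𝒴 × 𝒵 => pX a.1 * W a.1 a.2)
      = fun a : 𝒳 × 𝒴 => pX a.1 * w a.1 a.2 := by
    funext ⟨x, y⟩
    rw [pmap_fin, Fintype.sum_prod_type, Finset.sum_eq_single x]
    · rw [Fintype.sum_prod_type, Finset.sum_eq_single y]
      · simp [hw, Finset.mul_sum]
      · intro b _ hb; simp [hb]
      · simp
    · intro b _ hb; simp [hb]
    · simp
  have eZ : pmap (fun a : 𝒳 × 𝒴 × 𝒵 => (a.1, a.2.2)) (fun a : 𝒳 × 𝒴 × 𝒵 => pX a.1 * W a.1 a.2)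
      = fun a : 𝒳 × 𝒵 => pX a.1 * v a.1 a.2 := by
    funext ⟨x, z⟩
    rw [pmap_fin, Fintype.sum_prod_type, Finset.sum_eq_single x]
    · rw [Fintype.sum_prod_type]
      simp [hv, Finset.mul_sum]
    · intro b _ hb; simp [hb]
    · simp
  rw [eY, eZ, MI_eq pX w hWs, MI_eq pX v hWs'] at hR
  set IY := ∑ a, ∑ b, pX a * w a b * idens pX w a b with hIY
  set IZ := ∑ a, ∑ b, pX a * v a b * idens pX v a b with hIZ
  have hIZ0 : 0 ≤ IZ := MI_nonneg' pX hX hX1 v hv0 hWs'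
  obtain ⟨δ, hδ⟩ : ∃ δ, δ = (IY - IZ - R) / 4 := ⟨_, rfl⟩
  have hδ0 : 0 < δ := by rw [hδ]; linarith
  obtain ⟨ρ1, h10, h11, h1⟩ := tail_low pX hX hX1 w hw0 hWs (IY - δ) (by linarith)
  obtain ⟨ρ2, h20, h21, h2⟩ := tail_high pX hX hX1 v hv0 hWs' (IZ + δ) (by linarith)
  set ρ : ℝ := (2 : ℝ) ^ (-δ) with hρ
  have hρ0 : 0 ≤ ρ := by positivity
  have hρ1 : ρ < 1 := Real.rpow_lt_one_of_one_lt_of_neg (by norm_num) (by linarith)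
  have hlim : Filter.Tendsto (fun n : ℕ => (ρ1 ^ n + 4 * ρ ^ n) + (2 * ρ2 ^ n + √(ρ ^ n)))
      Filter.atTop (nhds 0) := by
    have t1 := tendsto_pow_atTop_nhds_zero_of_lt_one h10 h11
    have t2 := tendsto_pow_atTop_nhds_zero_of_lt_one h20 h21
    have t3 := tendsto_pow_atTop_nhds_zero_of_lt_one hρ0 hρ1
    have t4 := (Real.continuous_sqrt.tendsto 0).comp t3
    have := (t1.add (t3.const_mul 4)).add ((t2.const_mul 2).add t4)
    simpa using this
  obtain ⟨n, hn, hn0⟩ := ((hlim.eventually (gt_mem_nhds hε)).and (Filter.eventually_gt_atTop 0)).exists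
  have hM := nMsg_pos n R
  have hL := nMsg_pos n (IZ + 2 * δ)
  obtain ⟨c, dec, hcd⟩ := oneshot (A := Fin n → 𝒳) (B := Fin n → 𝒴) (C := Fin n → 𝒵)
    (fun x => ∏ i, pX (x i)) (fun x => Finset.prod_nonneg fun i _ => hX _)
    (by rw [sum_prod_one n (fun _ => pX)]; simp [hX1])
    (fun x y => ∏ i, w (x i) (y i)) (fun x y => Finset.prod_nonneg fun i _ => hw0 _ _)
    (fun x => by rw [sum_prod_one n (fun i => w (x i))]; exact Finset.prod_eq_one fun i _ => hWs _)
    (fun y => ∏ i, ∑ a, pX a * w a (y i))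
    (fun y => by
      rw [← sum_prod_one n (fun i a => pX a * w a (y i))]; simp only [Finset.prod_mul_distrib])
    ((2 : ℝ) ^ ((n : ℝ) * (IY - δ))) (by positivity)
    (fun x z => ∏ i, v (x i) (z i)) (fun x z => Finset.prod_nonneg fun i _ => hv0 _ _)
    (fun x => by rw [sum_prod_one n (fun i => v (x i))]; exact Finset.prod_eq_one fun i _ => hWs' _)
    (fun z => ∏ i, ∑ a, pX a * v a (z i))
    (fun z => by
      rw [← sum_prod_one n (fun i a => pX a * v a (z i))]; simp only [Finset.prod_mul_distrib])
    ((2 : ℝ) ^ ((n : ℝ) * (IZ + δ))) (by positivity) (nMsg n R) (nMsg n (IZ + 2 * δ)) hM hL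
  have hML : (nMsg n R : ℝ) * (nMsg n (IZ + 2 * δ) : ℝ) / (2 : ℝ) ^ ((n : ℝ) * (IY - δ)) ≤
      4 * ρ ^ n := by
    rw [div_le_iff₀ (by positivity), hρ, ← rate_pow]
    calc (nMsg n R : ℝ) * (nMsg n (IZ + 2 * δ) : ℝ)
        ≤ (2 * (2 : ℝ) ^ ((n : ℝ) * R)) * (2 * (2 : ℝ) ^ ((n : ℝ) * (IZ + 2 * δ))) :=
          mul_le_mul (ceil_le_two n R hR0) (ceil_le_two n _ (by linarith)) (by positivity)
            (by positivity)
      _ = 4 * ((2 : ℝ) ^ ((n : ℝ) * R) * (2 : ℝ) ^ ((n : ℝ) * (IZ + 2 * δ))) := by ring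
      _ = 4 * ((2 : ℝ) ^ ((n : ℝ) * (-δ)) * (2 : ℝ) ^ ((n : ℝ) * (IY - δ))) := by
          rw [← Real.rpow_add (by norm_num), ← Real.rpow_add (by norm_num)]
          congr 2
          rw [hδ]; ring
      _ = _ := by ring
  have hgL : √((2 : ℝ) ^ ((n : ℝ) * (IZ + δ)) / (nMsg n (IZ + 2 * δ) : ℝ)) ≤ √(ρ ^ n) := by
    apply Real.sqrt_le_sqrt
    have hLr : (0 : ℝ) < nMsg n (IZ + 2 * δ) := by exact_mod_cast hL
    rw [div_le_iff₀ hLr, hρ, ← rate_pow]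
    calc (2 : ℝ) ^ ((n : ℝ) * (IZ + δ))
        = (2 : ℝ) ^ ((n : ℝ) * (-δ)) * (2 : ℝ) ^ ((n : ℝ) * (IZ + 2 * δ)) := by
          rw [← Real.rpow_add (by norm_num)]
          congr 1
          ring
      _ ≤ _ := by
          gcongr
          exact Nat.le_ceil _
  have hbound := hcd.trans (add_le_add (add_le_add (h1 n) hML)
    (add_le_add (mul_le_mul_of_nonneg_left (h2 n) zero_le_two) hgL))
  have hfin := hbound.trans hn.le
  refine ⟨n, cbEnc hM c, dec, hn0, cbEnc_pmf hM hL c, ?_, ?_⟩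
  · rw [err_eq]
    refine le_trans ?_ hfin
    exact le_add_of_nonneg_right (by positivity)
  · refine (tv_le W n hM c (fun z => ∏ i, ∑ a, pX a * v a (z i))).trans (le_trans ?_ hfin)
    refine le_add_of_nonneg_left (mul_nonneg (by positivity) (Finset.sum_nonneg fun m _ =>
      mul_nonneg (by positivity) (Finset.sum_nonneg fun l _ => Finset.sum_nonneg fun y _ =>
        mul_nonneg (Finset.prod_nonneg fun i _ => hw0 _ _) ?_)))
    split_ifs <;> simp
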